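/- arXiv:2005.12907 — 6 statements merged into one kernel-verified Lean document; each statement's English description precedes it below -/
import Mathlib

section
/- Let n be a positive integer, let K be an n×n complex Hermitian positive definite matrix, let h ∈ ℂⁿ, and let α, λ, γ be positive real numbers. Suppose the matrix C := α K − α² λ h hᴴ is positive definite, where h hᴴ denotes the rank-one outer product. Then α² λ Re(hᴴ C⁻¹ h) ≥ γ if and only if α λ (1 + 1/γ) Re(hᴴ K⁻¹ h) ≥ 1. -/
open Matrix
open scoped ComplexOrder

/-- The Sherman–Morrison identity for quadratic forms: if `C = a K - b u vᵀ` with `C` and `K`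
invertible, then `a (vᵀ C⁻¹ u) = (1 + b (vᵀ C⁻¹ u)) (vᵀ K⁻¹ u)`. -/
theorem mul_dotProduct_inv_mulVec_of_eq_smul_sub_vecMulVec
    {m R : Type*} [Fintype m] [DecidableEq m] [CommRing R]
    {C K : Matrix m m R} {a b : R} {u v : m → R}
    (hC : IsUnit C.det) (hK : IsUnit K.det) (hCK : C = a • K - b • vecMulVec u v) :
    a * (v ⬝ᵥ C⁻¹ *ᵥ u) = (1 + b * (v ⬝ᵥ C⁻¹ *ᵥ u)) * (v ⬝ᵥ K⁻¹ *ᵥ u) := by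
  set x := C⁻¹ *ᵥ u with hx
  have hCx : C *ᵥ x = u := by
    rw [hx, mulVec_mulVec, mul_nonsing_inv _ hC, one_mulVec]
  have hKx : a • K *ᵥ x = (1 + b * (v ⬝ᵥ x)) • u := by
    rw [hCK, sub_mulVec, smul_mulVec, smul_mulVec, vecMulVec_mulVec, sub_eq_iff_eq_add] at hCx
    rw [hCx, add_smul, one_smul, mul_smul, op_smul_eq_smul]
  have hxK : a • x = (1 + b * (v ⬝ᵥ x)) • K⁻¹ *ᵥ u := by
    have := congrArg (K⁻¹ *ᵥ ·) hKx
    simpa only [mulVec_smul, mulVec_mulVec, nonsing_inv_mul _ hK, one_mulVec] using this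
  simpa only [dotProduct_smul, smul_eq_mul] using congrArg (v ⬝ᵥ ·) hxK

/-- Equivalence (via Sherman–Morrison) between the uplink SINR constraint evaluated at
the MMSE combiner, with interference-plus-noise covariance `C = α K − α² λ h hᴴ`, and
the scalar constraint of the simplified uplink power-minimization problem. -/
theorem sinr_constraint_iff_simplified_constraint
    (n : ℕ) (hn : 0 < n)
    (K : Matrix (Fin n) (Fin n) ℂ) (hK : K.PosDef)
    (h : Fin n → ℂ)
    (α lam γ : ℝ) (hα : 0 < α) (hlam : 0 < lam) (hγ : 0 < γ)
    (C : Matrix (Fin n) (Fin n) ℂ)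
    (hCdef : C = (α : ℂ) • K - ((α ^ 2 * lam : ℝ) : ℂ) • vecMulVec h (star h))
    (hC : C.PosDef) :
    γ ≤ α ^ 2 * lam * (star h ⬝ᵥ C⁻¹.mulVec h).re
      ↔ 1 ≤ α * lam * (1 + 1 / γ) * (star h ⬝ᵥ K⁻¹.mulVec h).re := by
  have key := mul_dotProduct_inv_mulVec_of_eq_smul_sub_vecMulVec
    ((isUnit_iff_isUnit_det C).mp hC.isUnit) ((isUnit_iff_isUnit_det K).mp hK.isUnit) hCdef
  obtain ⟨hc, hc_im⟩ := Complex.nonneg_iff.mp (hC.inv.posSemidef.dotProduct_mulVec_nonneg h)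
  set c := star h ⬝ᵥ C⁻¹ *ᵥ h
  set k := star h ⬝ᵥ K⁻¹ *ᵥ h
  have key_re : α * c.re = (1 + α ^ 2 * lam * c.re) * k.re := by
    simpa [← hc_im, -Complex.ofReal_mul, -Complex.ofReal_pow] using congrArg Complex.re key
  have hs : 0 < 1 + α ^ 2 * lam * c.re := by positivity
  have hk : k.re = α * c.re / (1 + α ^ 2 * lam * c.re) := by
    rw [eq_div_iff hs.ne', key_re, mul_comm]
  have hform : α * lam * (1 + 1 / γ) * k.re
      = (γ + 1) * (α ^ 2 * lam * c.re) / (γ * (1 + α ^ 2 * lam * c.re)) := by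
    rw [hk]
    field_simp
  rw [hform, one_le_div (mul_pos hγ hs)]
  constructor <;> intro hle <;> linarith
end

section
/- Let n be a positive integer, let K be an n×n complex Hermitian positive definite matrix, let h ∈ ℂⁿ with h ≠ 0, and let α, λ, γ be positive real numbers. Suppose the matrix C := α K − α² λ h hᴴ is positive definite. Then α² λ Re(hᴴ C⁻¹ h) = γ if and only if λ = 1 / (α (1 + 1/γ) Re(hᴴ K⁻¹ h)). In particular Re(hᴴ K⁻¹ h) > 0, so the right-hand side is well defined. -/
open Matrix
open scoped ComplexOrder

/-- Dotting the equation `(a K - c v vᴴ) x = v`, solved by `x = C⁻¹ v`, with `vᴴ K⁻¹` relates the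
quadratic forms of `C⁻¹` and `K⁻¹` at `v`. -/
theorem Matrix.smul_dotProduct_inv_of_rankOne_update {m R : Type*} [Fintype m] [DecidableEq m]
    [CommRing R] [StarRing R] {K C : Matrix m m R} (hK : IsUnit K.det) (hC : IsUnit C.det)
    {v : m → R} {a c : R} (hCK : C = a • K - c • vecMulVec v (star v)) :
    a * (star v ⬝ᵥ C⁻¹ *ᵥ v) = (1 + c * (star v ⬝ᵥ C⁻¹ *ᵥ v)) * (star v ⬝ᵥ K⁻¹ *ᵥ v) := by
  have hCx : C *ᵥ (C⁻¹ *ᵥ v) = v := by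
    rw [mulVec_mulVec, mul_nonsing_inv _ hC, one_mulVec]
  generalize C⁻¹ *ᵥ v = x at hCx ⊢
  rw [hCK, sub_mulVec, smul_mulVec, smul_mulVec, vecMulVec_mulVec, op_smul_eq_smul] at hCx
  have hdot := congrArg (fun y => star v ⬝ᵥ K⁻¹ *ᵥ y) hCx
  simp only [mulVec_sub, mulVec_smul, dotProduct_sub, dotProduct_smul, smul_eq_mul] at hdot
  rw [mulVec_mulVec, nonsing_inv_mul _ hK, one_mulVec] at hdot
  linear_combination hdot

/-- The SINR constraint with target `γ`, evaluated at the MMSE combiner with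
interference-plus-noise covariance `C = α K − α² λ h hᴴ`, is active exactly when the
transmit power equals `λ = 1 / (α (1 + 1/γ) Re(hᴴ K⁻¹ h))`; in particular
`Re(hᴴ K⁻¹ h) > 0`. -/
theorem sinr_active_iff_optimal_power
    (n : ℕ) (hn : 0 < n)
    (K : Matrix (Fin n) (Fin n) ℂ) (hK : K.PosDef)
    (h : Fin n → ℂ) (hh : h ≠ 0)
    (α lam γ : ℝ) (hα : 0 < α) (hlam : 0 < lam) (hγ : 0 < γ)
    (C : Matrix (Fin n) (Fin n) ℂ)
    (hCdef : C = (α : ℂ) • K - ((α ^ 2 * lam : ℝ) : ℂ) • vecMulVec h (star h))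
    (hC : C.PosDef) :
    0 < (star h ⬝ᵥ K⁻¹.mulVec h).re ∧
    (α ^ 2 * lam * (star h ⬝ᵥ C⁻¹.mulVec h).re = γ
      ↔ lam = 1 / (α * (1 + 1 / γ) * (star h ⬝ᵥ K⁻¹.mulVec h).re)) := by
  have hKpos := Complex.pos_iff.mp (hK.inv.dotProduct_mulVec_pos hh)
  have hCpos := Complex.pos_iff.mp (hC.inv.dotProduct_mulVec_pos hh)
  have key := congrArg Complex.re (Matrix.smul_dotProduct_inv_of_rankOne_update
    ((isUnit_iff_isUnit_det K).mp hK.isUnit) ((isUnit_iff_isUnit_det C).mp hC.isUnit) hCdef)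
  rw [Complex.re_ofReal_mul, Complex.mul_re, ← hKpos.2, mul_zero, sub_zero, Complex.add_re,
    Complex.one_re, Complex.re_ofReal_mul] at key
  refine ⟨hKpos.1, ?_⟩
  have ha := hKpos.1
  generalize (star h ⬝ᵥ K⁻¹ *ᵥ h).re = a at key ha ⊢
  generalize (star h ⬝ᵥ C⁻¹ *ᵥ h).re = b at key ⊢
  have hden : α * (1 + 1 / γ) * a ≠ 0 := by positivity
  have hlam_iff : lam = 1 / (α * (1 + 1 / γ) * a) ↔ lam * α * (γ + 1) * a = γ := by
    rw [eq_div_iff hden]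
    field_simp
  rw [hlam_iff]
  constructor <;> intro hs
  · rw [hs] at key
    linear_combination hs - α * lam * key
  · linear_combination (1 + α ^ 2 * lam * b) * hs + (γ + 1) * α * lam * key
end

section
/- Let I be a nonempty finite index set and let F : ℝ^I → ℝ^I be a standard function. If λ, λ' ∈ ℝ^I are both componentwise nonnegative fixed points of F, i.e. λ ≥ 0, λ' ≥ 0, F(λ) = λ and F(λ') = λ', then λ = λ' (uniqueness of the fixed point of a standard interference function). -/
/-- A map `F : ℝ^I → ℝ^I` is a *standard interference function* if it satisfies
positivity, monotonicity, and scalability. -/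
def IsStandard {I : Type*} (F : (I → ℝ) → (I → ℝ)) : Prop :=
  (∀ lam : I → ℝ, (∀ i, 0 ≤ lam i) → ∀ i, 0 < F lam i) ∧
  (∀ lam lam' : I → ℝ, (∀ i, 0 ≤ lam i) → (∀ i, lam i ≤ lam' i) →
      ∀ i, F lam i ≤ F lam' i) ∧
  (∀ ρ : ℝ, 1 < ρ → ∀ lam : I → ℝ, (∀ i, 0 ≤ lam i) →
      ∀ i, F (fun j => ρ * lam j) i < ρ * F lam i)

/-- A nonnegative fixed point of a standard interference function lies below every other one. -/
theorem IsStandard.fixed_point_le {I : Type*} [Finite I] [Nonempty I]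
    {F : (I → ℝ) → (I → ℝ)} (hF : IsStandard F) {lam lam' : I → ℝ}
    (hlam : ∀ i, 0 ≤ lam i) (hlam' : ∀ i, 0 ≤ lam' i)
    (hfix : F lam = lam) (hfix' : F lam' = lam') : ∀ i, lam i ≤ lam' i := by
  obtain ⟨hpos, hmono, hscal⟩ := hF
  have hpos' : ∀ i, 0 < lam' i := fun i => by simpa only [hfix'] using hpos lam' hlam' i
  obtain ⟨m, hm⟩ := Finite.exists_max fun i => lam i / lam' i
  by_cases hρ : lam m / lam' m ≤ 1
  · exact fun i => (div_le_one (hpos' i)).1 ((hm i).trans hρ)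
  · have hle := hmono lam (fun j => lam m / lam' m * lam' j) hlam
      (fun i => (div_le_iff₀ (hpos' i)).1 (hm i)) m
    have hlt := hscal _ (not_le.1 hρ) lam' hlam' m
    rw [hfix', div_mul_cancel₀ _ (hpos' m).ne'] at hlt
    rw [hfix] at hle
    exact absurd hle hlt.not_ge

/-- Uniqueness of the componentwise nonnegative fixed point of a standard interference
function. -/
theorem standard_fixed_point_unique
    (I : Type*) [Fintype I] [Nonempty I]
    (F : (I → ℝ) → (I → ℝ)) (hF : IsStandard F)
    (lam lam' : I → ℝ)
    (hlam : ∀ i, 0 ≤ lam i) (hlam' : ∀ i, 0 ≤ lam' i)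
    (hfix : F lam = lam) (hfix' : F lam' = lam') :
    lam = lam' := by
  exact funext fun i => le_antisymm (hF.fixed_point_le hlam hlam' hfix hfix' i)
    (hF.fixed_point_le hlam' hlam hfix' hfix i)
end

section
/- Let I be a nonempty finite index set and let F : ℝ^I → ℝ^I be a standard function that is continuous and admits a componentwise nonnegative fixed point λ* (F(λ*) = λ*, λ* ≥ 0). Define the iterates λ⁽⁰⁾ := 0 and λ⁽ⁿ⁺¹⁾ := F(λ⁽ⁿ⁾) for n ≥ 0. Then the sequence (λ⁽ⁿ⁾) is componentwise nondecreasing, satisfies λ⁽ⁿ⁾ ≤ λ* componentwise for all n, and converges to λ*, the unique componentwise nonnegative fixed point of F. -/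
open Filter Topology

namespace IsStandard

variable {I : Type*} {F : (I → ℝ) → (I → ℝ)}

/-- Any nonnegative fixed point of a standard function lies below any other one. -/
theorem fixedPoint_le [Finite I] (hF : IsStandard F) {μ ν : I → ℝ}
    (hμ : ∀ i, 0 ≤ μ i) (hν : ∀ i, 0 ≤ ν i) (hFμ : F μ = μ) (hFν : F ν = ν) (j : I) :
    μ j ≤ ν j := by
  obtain ⟨hpos, hmono, hscal⟩ := hF
  have hν_pos : ∀ i, 0 < ν i := fun i => by
    have h := hpos ν hν i
    rwa [hFν] at h
  have : Nonempty I := ⟨j⟩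
  obtain ⟨i, hi⟩ := Finite.exists_max (fun k => μ k / ν k)
  by_contra! hj
  have hρ : 1 < μ i / ν i := ((one_lt_div (hν_pos j)).2 hj).trans_le (hi j)
  have h_le : ∀ k, μ k ≤ μ i / ν i * ν k := fun k => (div_le_iff₀ (hν_pos k)).1 (hi k)
  have h_lt := (hmono μ _ hμ h_le i).trans_lt (hscal _ hρ ν hν i)
  rw [hFμ, hFν, div_mul_cancel₀ _ (hν_pos i).ne'] at h_lt
  exact lt_irrefl _ h_lt

/-- A standard function on a finite index set has at most one nonnegative fixed point. -/
theorem fixedPoint_unique [Finite I] (hF : IsStandard F) {μ ν : I → ℝ}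
    (hμ : ∀ i, 0 ≤ μ i) (hν : ∀ i, 0 ≤ ν i) (hFμ : F μ = μ) (hFν : F ν = ν) : μ = ν :=
  funext fun i => le_antisymm (hF.fixedPoint_le hμ hν hFμ hFν i) (hF.fixedPoint_le hν hμ hFν hFμ i)

end IsStandard

/-- For a continuous standard interference function admitting a componentwise
nonnegative fixed point `λ*`, the iterates started from `0` are componentwise
nondecreasing, bounded above by `λ*`, and converge to `λ*`, which is the unique
componentwise nonnegative fixed point. -/
theorem standard_iteration_from_zero_converges
    (I : Type*) [Fintype I] [Nonempty I]
    (F : (I → ℝ) → (I → ℝ)) (hF : IsStandard F) (hcont : Continuous F)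
    (lamStar : I → ℝ) (hstar_nonneg : ∀ i, 0 ≤ lamStar i)
    (hstar_fix : F lamStar = lamStar)
    (lamSeq : ℕ → (I → ℝ))
    (h0 : lamSeq 0 = 0)
    (hrec : ∀ n, lamSeq (n + 1) = F (lamSeq n)) :
    (∀ n i, lamSeq n i ≤ lamSeq (n + 1) i) ∧
    (∀ n i, lamSeq n i ≤ lamStar i) ∧
    Tendsto lamSeq atTop (𝓝 lamStar) ∧
    (∀ μ : I → ℝ, (∀ i, 0 ≤ μ i) → F μ = μ → μ = lamStar) := by
  have hnonneg : ∀ n i, 0 ≤ lamSeq n i := by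
    intro n
    induction n with
    | zero => simp [h0]
    | succ n ih => exact fun i => hrec n ▸ (hF.1 _ ih i).le
  have hstep : ∀ n i, lamSeq n i ≤ lamSeq (n + 1) i := by
    intro n
    induction n with
    | zero => exact fun i => by simpa [h0] using hnonneg 1 i
    | succ n ih =>
      intro i
      rw [hrec (n + 1), hrec n]
      exact hF.2.1 _ _ (hnonneg n) (fun j => (ih j).trans_eq (congrFun (hrec n) j)) i
  have hle : ∀ n i, lamSeq n i ≤ lamStar i := by
    intro n
    induction n with
    | zero => simpa [h0] using hstar_nonneg
    | succ n ih =>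
      intro i
      rw [hrec n, ← hstar_fix]
      exact hF.2.1 _ _ (hnonneg n) ih i
  refine ⟨hstep, hle, ?_, fun μ hμ hfix => hF.fixedPoint_unique hμ hstar_nonneg hfix hstar_fix⟩
  have hlim : Tendsto lamSeq atTop (𝓝 fun i => ⨆ n, lamSeq n i) :=
    tendsto_pi_nhds.2 fun i => tendsto_atTop_ciSup
      (monotone_nat_of_le_succ fun n => hstep n i) ⟨lamStar i, by rintro _ ⟨n, rfl⟩; exact hle n i⟩
  have hlim_fix : F (fun i => ⨆ n, lamSeq n i) = fun i => ⨆ n, lamSeq n i := by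
    refine tendsto_nhds_unique ((hcont.tendsto _).comp hlim) ?_
    exact ((tendsto_add_atTop_iff_nat 1).2 hlim).congr hrec
  have hlim_nonneg : ∀ i, 0 ≤ ⨆ n, lamSeq n i := fun i => Real.iSup_nonneg fun n => hnonneg n i
  rwa [hF.fixedPoint_unique hlim_nonneg hstar_nonneg hlim_fix hstar_fix] at hlim
end

section
/- Let I be a nonempty finite index set and let F : ℝ^I → ℝ^I be a standard function. Suppose λ⁽⁰⁾ ∈ ℝ^I satisfies λ⁽⁰⁾ ≥ 0 componentwise and F(λ⁽⁰⁾) ≤ λ⁽⁰⁾ componentwise, and define λ⁽ⁿ⁺¹⁾ := F(λ⁽ⁿ⁾) for n ≥ 0. Then the sequence (λ⁽ⁿ⁾) is componentwise nonincreasing and componentwise nonnegative for all n, hence converges in ℝ^I; if moreover F is continuous, the limit is a fixed point of F. -/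
open Filter Topology

/-- Starting the iteration of a standard interference function from a componentwise
nonnegative point `λ⁽⁰⁾` with `F(λ⁽⁰⁾) ≤ λ⁽⁰⁾`, the iterates are componentwise
nonincreasing and nonnegative, hence converge; if `F` is continuous, the limit is a
fixed point of `F`. -/
theorem standard_iteration_monotone_decreasing_converges
    (I : Type*) [Fintype I] [Nonempty I]
    (F : (I → ℝ) → (I → ℝ)) (hF : IsStandard F)
    (lamSeq : ℕ → (I → ℝ))
    (h0_nonneg : ∀ i, 0 ≤ lamSeq 0 i)
    (h0_dec : ∀ i, F (lamSeq 0) i ≤ lamSeq 0 i)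
    (hrec : ∀ n, lamSeq (n + 1) = F (lamSeq n)) :
    (∀ n i, lamSeq (n + 1) i ≤ lamSeq n i) ∧
    (∀ n i, 0 ≤ lamSeq n i) ∧
    ∃ L : I → ℝ, Tendsto lamSeq atTop (𝓝 L) ∧ (Continuous F → F L = L) := by
  have nonneg : ∀ n i, 0 ≤ lamSeq n i := by
    intro n
    induction n with
    | zero => exact h0_nonneg
    | succ n ih => exact fun i => hrec n ▸ (hF.1 _ ih i).le
  have dec : ∀ n i, lamSeq (n + 1) i ≤ lamSeq n i := by
    intro n
    induction n with
    | zero => exact fun i => hrec 0 ▸ h0_dec i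
    | succ n ih =>
      intro i
      rw [hrec (n + 1)]
      conv_rhs => rw [hrec n]
      exact hF.2.1 _ _ (nonneg (n + 1)) ih i
  have lim : Tendsto lamSeq atTop (𝓝 fun i => ⨅ n, lamSeq n i) :=
    tendsto_pi_nhds.2 fun i =>
      tendsto_atTop_ciInf (antitone_nat_of_succ_le fun n => dec n i)
        ⟨0, Set.forall_mem_range.2 fun n => nonneg n i⟩
  refine ⟨dec, nonneg, _, lim, fun hcont => ?_⟩
  refine tendsto_nhds_unique ((hcont.tendsto _).comp lim) ?_
  simpa only [Function.comp_def, hrec] using lim.comp (tendsto_add_atTop_nat 1)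
end

section
/- Let n be a positive integer, let K be an n×n complex Hermitian positive definite matrix, let h ∈ ℂⁿ, let c > 0 be real, and suppose w ∈ ℂⁿ satisfies (K − c · h hᴴ) w = 0 and hᴴ w ≠ 0. Then c · Re(hᴴ K⁻¹ h) = 1; equivalently, writing c = α (1 + 1/γ) λ with α, γ, λ > 0, the Lagrange multiplier satisfies λ = 1 / (α (1 + 1/γ) Re(hᴴ K⁻¹ h)). -/
open Matrix
open scoped ComplexOrder

/-- If a rank-one perturbation `K - a • u vᵀ` of an invertible matrix kills a vector `w` with
`v ⬝ᵥ w ≠ 0`, then `a * (v ⬝ᵥ K⁻¹ u) = 1`. -/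
theorem Matrix.mul_dotProduct_inv_mulVec_eq_one {m F : Type*} [Fintype m] [DecidableEq m]
    [Field F] {K : Matrix m m F} (hK : IsUnit K.det) {a : F} {u v w : m → F}
    (hw : (K - a • vecMulVec u v) *ᵥ w = 0) (hvw : v ⬝ᵥ w ≠ 0) :
    a * (v ⬝ᵥ K⁻¹ *ᵥ u) = 1 := by
  have hKw : K *ᵥ w = (a * (v ⬝ᵥ w)) • u := by
    rw [sub_mulVec, sub_eq_zero, smul_mulVec, vecMulVec_mulVec, op_smul_eq_smul, smul_smul] at hw
    exact hw
  have hw_eq : w = (a * (v ⬝ᵥ w)) • K⁻¹ *ᵥ u := by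
    rw [← mulVec_smul, ← hKw, mulVec_mulVec, nonsing_inv_mul K hK, one_mulVec]
  have hdot := congrArg (v ⬝ᵥ ·) hw_eq
  simp only [dotProduct_smul, smul_eq_mul] at hdot
  apply mul_right_cancel₀ hvw
  linear_combination -hdot

/-- Stationarity condition of the downlink Lagrangian: if `(K − c h hᴴ) w = 0` for a
nonzero stationary precoder `w` not orthogonal to the direct channel `h` (i.e.
`hᴴ w ≠ 0`), then `c · Re(hᴴ K⁻¹ h) = 1`; equivalently, writing
`c = α (1 + 1/γ) λ`, the multiplier satisfies
`λ = 1 / (α (1 + 1/γ) Re(hᴴ K⁻¹ h))`. -/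
theorem stationarity_pins_down_power
    (n : ℕ) (hn : 0 < n)
    (K : Matrix (Fin n) (Fin n) ℂ) (hK : K.PosDef)
    (h : Fin n → ℂ) (c : ℝ) (hc : 0 < c)
    (w : Fin n → ℂ)
    (hstat : (K - (c : ℂ) • vecMulVec h (star h)).mulVec w = 0)
    (hnz : star h ⬝ᵥ w ≠ 0) :
    c * (star h ⬝ᵥ K⁻¹.mulVec h).re = 1 ∧
    ∀ α γ lam : ℝ, 0 < α → 0 < γ → 0 < lam →
      c = α * (1 + 1 / γ) * lam →
      lam = 1 / (α * (1 + 1 / γ) * (star h ⬝ᵥ K⁻¹.mulVec h).re) := by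
  have hone := mul_dotProduct_inv_mulVec_eq_one
    ((isUnit_iff_isUnit_det K).mp hK.isUnit) hstat hnz
  have hre : c * (star h ⬝ᵥ K⁻¹.mulVec h).re = 1 := by
    simpa only [Complex.re_ofReal_mul, Complex.one_re] using congrArg Complex.re hone
  refine ⟨hre, fun α γ lam _ _ _ hc_eq => ?_⟩
  rw [hc_eq] at hre
  apply eq_one_div_of_mul_eq_one_left
  linear_combination hre
end
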